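/- Let (M,·,1) be a monoid and let S be a naturally ordered ω-continuous M-module. Then for every M-wGCL program C, the transformer wp[C] is monotone: for all weightings f, g with f ⪯ g (pointwise natural order), wp[C](f) ⪯ wp[C](g). -/

import Mathlib

/-! ## Monoid modules, natural order, ω-(co)continuity -/

structure MonModule (M : Type) [Monoid M] (S : Type) where
  add : S → S → S
  zero : S
  smul : M → S → S
  add_assoc : ∀ a b c : S, add (add a b) c = add a (add b c)
  add_comm : ∀ a b : S, add a b = add b a
  add_zero : ∀ a : S, add a zero = a
  smul_assoc : ∀ (u v : M) (a : S), smul (u * v) a = smul u (smul v a)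
  smul_add : ∀ (u : M) (a b : S), smul u (add a b) = add (smul u a) (smul u b)
  one_smul : ∀ a : S, smul 1 a = a
  smul_zero : ∀ u : M, smul u zero = zero

namespace MonModule

variable {M S : Type} [Monoid M]

/-- The natural (pre)order: `a ⪯ b` iff `∃ c, a ⊕ c = b`. -/
def le (mm : MonModule M S) (a b : S) : Prop := ∃ c : S, mm.add a c = b

/-- `S` is naturally ordered if the natural order is antisymmetric (hence a partial order). -/
def NaturallyOrdered (mm : MonModule M S) : Prop :=
  ∀ a b : S, mm.le a b → mm.le b a → a = b

/-- ω-chain (ascending). -/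
def Chain (mm : MonModule M S) (s : ℕ → S) : Prop := ∀ n : ℕ, mm.le (s n) (s (n + 1))

/-- ω-descending chain. -/
def DChain (mm : MonModule M S) (s : ℕ → S) : Prop := ∀ n : ℕ, mm.le (s (n + 1)) (s n)

/-- `x` is the supremum (least upper bound) of `s` w.r.t. the natural order. -/
def IsSup (mm : MonModule M S) (s : ℕ → S) (x : S) : Prop :=
  (∀ n : ℕ, mm.le (s n) x) ∧ ∀ y : S, (∀ n : ℕ, mm.le (s n) y) → mm.le x y

/-- `x` is the infimum (greatest lower bound) of `s` w.r.t. the natural order. -/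
def IsInf (mm : MonModule M S) (s : ℕ → S) (x : S) : Prop :=
  (∀ n : ℕ, mm.le x (s n)) ∧ ∀ y : S, (∀ n : ℕ, mm.le y (s n)) → mm.le y x

end MonModule

/-- `S` is ω-continuous: suprema of ω-chains exist (with least element `𝟘`, which is
automatically least for the natural order), and `⊕`, `⊗` are ω-continuous. -/
structure OmegaContinuous {M S : Type} [Monoid M] (mm : MonModule M S) : Prop where
  sup_exists : ∀ s : ℕ → S, mm.Chain s → ∃ x : S, mm.IsSup s x
  add_cont : ∀ (a : S) (s : ℕ → S) (x : S), mm.Chain s → mm.IsSup s x →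
    mm.IsSup (fun n => mm.add a (s n)) (mm.add a x)
  smul_cont : ∀ (u : M) (s : ℕ → S) (x : S), mm.Chain s → mm.IsSup s x →
    mm.IsSup (fun n => mm.smul u (s n)) (mm.smul u x)

/-- `S` is ω-cocontinuous: a greatest element exists, infima of ω-descending chains exist,
and `⊕`, `⊗` are ω-cocontinuous. -/
structure OmegaCocontinuous {M S : Type} [Monoid M] (mm : MonModule M S) : Prop where
  top_exists : ∃ t : S, ∀ a : S, mm.le a t
  inf_exists : ∀ s : ℕ → S, mm.DChain s → ∃ x : S, mm.IsInf s x
  add_cocont : ∀ (a : S) (s : ℕ → S) (x : S), mm.DChain s → mm.IsInf s x →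
    mm.IsInf (fun n => mm.add a (s n)) (mm.add a x)
  smul_cocont : ∀ (u : M) (s : ℕ → S) (x : S), mm.DChain s → mm.IsInf s x →
    mm.IsInf (fun n => mm.smul u (s n)) (mm.smul u x)

def OmegaBicontinuous {M S : Type} [Monoid M] (mm : MonModule M S) : Prop :=
  OmegaContinuous mm ∧ OmegaCocontinuous mm

/-! ## Weightings (pointwise lifting to `St → S`) -/

section Weightings

variable {M S St : Type} [Monoid M]

/-- Pointwise natural order on weightings. -/
def wle (mm : MonModule M S) (f g : St → S) : Prop := ∀ σ : St, mm.le (f σ) (g σ)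

def WChain (mm : MonModule M S) (s : ℕ → St → S) : Prop := ∀ n : ℕ, wle mm (s n) (s (n + 1))

def WDChain (mm : MonModule M S) (s : ℕ → St → S) : Prop := ∀ n : ℕ, wle mm (s (n + 1)) (s n)

def WIsSup (mm : MonModule M S) (s : ℕ → St → S) (x : St → S) : Prop :=
  (∀ n : ℕ, wle mm (s n) x) ∧ ∀ y : St → S, (∀ n : ℕ, wle mm (s n) y) → wle mm x y

def WIsInf (mm : MonModule M S) (s : ℕ → St → S) (x : St → S) : Prop :=
  (∀ n : ℕ, wle mm x (s n)) ∧ ∀ y : St → S, (∀ n : ℕ, wle mm y (s n)) → wle mm y x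

end Weightings

/-! ## wGCL syntax -/

/-- wGCL programs over weights from `M` and program states from `St`:
assignments (as state transformations), sequencing, conditionals, nondeterministic
branching, weighting `⊙ a`, and loops. -/
inductive WGCL (M : Type) (St : Type) : Type
  | assign : (St → St) → WGCL M St
  | seq : WGCL M St → WGCL M St → WGCL M St
  | ite : Set St → WGCL M St → WGCL M St → WGCL M St
  | branch : WGCL M St → WGCL M St → WGCL M St
  | weight : M → WGCL M St
  | wloop : Set St → WGCL M St → WGCL M St

section Transformers

variable {M S St : Type} [Monoid M]

/-- Iverson-bracket guarding `[φ] ⋄ f`. -/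
noncomputable def iv (mm : MonModule M S) (φ : Set St) (f : St → S) : St → S :=
  fun σ => @ite _ (σ ∈ φ) (Classical.propDecidable _) (f σ) mm.zero

/-- Least fixed point of `Φ` w.r.t. the pointwise natural order (chosen by classical choice
if it exists; arbitrary otherwise). -/
noncomputable def wlfp (mm : MonModule M S) (Φ : (St → S) → St → S) : St → S :=
  @dite _ (∃ x : St → S, Φ x = x ∧ ∀ y : St → S, Φ y = y → wle mm x y)
    (Classical.propDecidable _) (fun h => h.choose) (fun _ => fun _ => mm.zero)

/-- Greatest fixed point of `Φ` w.r.t. the pointwise natural order. -/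
noncomputable def wgfp (mm : MonModule M S) (Φ : (St → S) → St → S) : St → S :=
  @dite _ (∃ x : St → S, Φ x = x ∧ ∀ y : St → S, Φ y = y → wle mm y x)
    (Classical.propDecidable _) (fun h => h.choose) (fun _ => fun _ => mm.zero)

/-- Weakest preweighting transformer `wp`. -/
noncomputable def wp (mm : MonModule M S) : WGCL M St → (St → S) → St → S
  | WGCL.assign g => fun f σ => f (g σ)
  | WGCL.seq C₁ C₂ => fun f => wp mm C₁ (wp mm C₂ f)
  | WGCL.ite φ C₁ C₂ => fun f σ => mm.add (iv mm φ (wp mm C₁ f) σ) (iv mm φᶜ (wp mm C₂ f) σ)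
  | WGCL.branch C₁ C₂ => fun f σ => mm.add (wp mm C₁ f σ) (wp mm C₂ f σ)
  | WGCL.weight a => fun f σ => mm.smul a (f σ)
  | WGCL.wloop φ C' => fun f =>
      wlfp mm (fun X σ => mm.add (iv mm φᶜ f σ) (iv mm φ (wp mm C' X) σ))

/-- The `wp`-characteristic function `Φ_f(X) = [¬φ]⋄f ⊕ [φ]⋄wp[C'](X)` of `while(φ){C'}`. -/
noncomputable def charW (mm : MonModule M S) (φ : Set St) (C' : WGCL M St) (f : St → S)
    (X : St → S) : St → S :=
  fun σ => mm.add (iv mm φᶜ f σ) (iv mm φ (wp mm C' X) σ)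

/-- Weakest liberal preweighting transformer `wlp`. -/
noncomputable def wlp (mm : MonModule M S) : WGCL M St → (St → S) → St → S
  | WGCL.assign g => fun f σ => f (g σ)
  | WGCL.seq C₁ C₂ => fun f => wlp mm C₁ (wlp mm C₂ f)
  | WGCL.ite φ C₁ C₂ => fun f σ => mm.add (iv mm φ (wlp mm C₁ f) σ) (iv mm φᶜ (wlp mm C₂ f) σ)
  | WGCL.branch C₁ C₂ => fun f σ => mm.add (wlp mm C₁ f σ) (wlp mm C₂ f σ)
  | WGCL.weight a => fun f σ => mm.smul a (f σ)
  | WGCL.wloop φ C' => fun f =>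
      wgfp mm (fun X σ => mm.add (iv mm φᶜ f σ) (iv mm φ (wlp mm C' X) σ))

/-- The `wlp`-characteristic function `Ψ_f(X) = [¬φ]⋄f ⊕ [φ]⋄wlp[C'](X)` of `while(φ){C'}`. -/
noncomputable def charWlp (mm : MonModule M S) (φ : Set St) (C' : WGCL M St) (f : St → S)
    (X : St → S) : St → S :=
  fun σ => mm.add (iv mm φᶜ f σ) (iv mm φ (wlp mm C' X) σ)

end Transformers

/-! ## Operational semantics -/

/-- Configurations: `none` is a terminal configuration. -/
abbrev Conf (M St : Type) := Option (WGCL M St) × St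

section Operational

variable {M St : Type} [Monoid M]

/-- Weighted small-step operational semantics: each transition carries a weight in `M`
(the weight `a` for executing `⊙ a`, and `1` otherwise). -/
inductive Step : Conf M St → M → Conf M St → Prop
  | assign (g : St → St) (σ : St) : Step (some (WGCL.assign g), σ) 1 (none, g σ)
  | weight (a : M) (σ : St) : Step (some (WGCL.weight a), σ) a (none, σ)
  | seq_fin {C₁ : WGCL M St} {σ : St} {w : M} {σ' : St} (C₂ : WGCL M St) :
      Step (some C₁, σ) w (none, σ') → Step (some (WGCL.seq C₁ C₂), σ) w (some C₂, σ')
  | seq_step {C₁ : WGCL M St} {σ : St} {w : M} {C₁' : WGCL M St} {σ' : St} (C₂ : WGCL M St) :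
      Step (some C₁, σ) w (some C₁', σ') →
      Step (some (WGCL.seq C₁ C₂), σ) w (some (WGCL.seq C₁' C₂), σ')
  | ite_left {φ : Set St} {σ : St} (C₁ C₂ : WGCL M St) :
      σ ∈ φ → Step (some (WGCL.ite φ C₁ C₂), σ) 1 (some C₁, σ)
  | ite_right {φ : Set St} {σ : St} (C₁ C₂ : WGCL M St) :
      σ ∉ φ → Step (some (WGCL.ite φ C₁ C₂), σ) 1 (some C₂, σ)
  | branch_left (C₁ C₂ : WGCL M St) (σ : St) :
      Step (some (WGCL.branch C₁ C₂), σ) 1 (some C₁, σ)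
  | branch_right (C₁ C₂ : WGCL M St) (σ : St) :
      Step (some (WGCL.branch C₁ C₂), σ) 1 (some C₂, σ)
  | loop_enter {φ : Set St} {σ : St} (C : WGCL M St) :
      σ ∈ φ → Step (some (WGCL.wloop φ C), σ) 1 (some (WGCL.seq C (WGCL.wloop φ C)), σ)
  | loop_exit {φ : Set St} {σ : St} (C : WGCL M St) :
      σ ∉ φ → Step (some (WGCL.wloop φ C), σ) 1 (none, σ)

/-- A finite computation path from configuration `c`, recorded as the list of
(transition weight, successor configuration) pairs. -/
inductive Steps : Conf M St → List (M × Conf M St) → Prop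
  | nil (c : Conf M St) : Steps c []
  | cons {c : Conf M St} {w : M} {c' : Conf M St} {l : List (M × Conf M St)} :
      Step c w c' → Steps c' l → Steps c ((w, c') :: l)

/-- Weight of a computation path: the ordered product of its transition weights. -/
def pathWeight (l : List (M × Conf M St)) : M := (l.map Prod.fst).prod

/-- Final state of a (nonempty) computation path; `σ` for the empty path. -/
def lastState (σ : St) (l : List (M × Conf M St)) : St :=
  (l.getLastD ((1 : M), ((none : Option (WGCL M St)), σ))).2.2

/-- A terminating computation path from `c`: a finite path ending in a terminal
configuration. -/
def TermPath (c : Conf M St) (l : List (M × Conf M St)) : Prop :=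
  Steps c l ∧ ∃ p : M × Conf M St, l.getLast? = some p ∧ p.2.1 = (none : Option (WGCL M St))

/-- There is an infinite computation path starting in `c`. -/
def InfinitePathFrom (c : Conf M St) : Prop :=
  ∃ π : ℕ → Conf M St, π 0 = c ∧ ∀ n : ℕ, ∃ w : M, Step (π n) w (π (n + 1))

end Operational

/-! ## Countable module sums as suprema of finite partial sums -/

section Sums

variable {M S : Type} [Monoid M]

/-- Finite sum of `g` over the elements of a list. -/
def finListSum (mm : MonModule M S) {ι : Type} (g : ι → S) : List ι → S
  | [] => mm.zero
  | i :: t => mm.add (g i) (finListSum mm g t)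

/-- `x` is the (countable) module sum `⨁_{i ∈ T} g i`, i.e. the least upper bound
of all finite partial sums over duplicate-free lists of elements of `T`. -/
def IsSumOver (mm : MonModule M S) {ι : Type} (T : Set ι) (g : ι → S) (x : S) : Prop :=
  (∀ l : List ι, l.Nodup → (∀ i ∈ l, i ∈ T) → mm.le (finListSum mm g l) x) ∧
  ∀ y : S, (∀ l : List ι, l.Nodup → (∀ i ∈ l, i ∈ T) → mm.le (finListSum mm g l) y) → mm.le x y

end Sums

section Order

variable {M S : Type} [Monoid M] (mm : MonModule M S)

theorem MonModule.le_refl (a : S) : mm.le a a := ⟨mm.zero, mm.add_zero a⟩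

variable {mm}

theorem MonModule.le_of_eq {a b : S} (h : a = b) : mm.le a b := h ▸ mm.le_refl a

theorem MonModule.le_trans {a b c : S} : mm.le a b → mm.le b c → mm.le a c := by
  rintro ⟨u, rfl⟩ ⟨v, rfl⟩
  exact ⟨mm.add u v, (mm.add_assoc a u v).symm⟩

theorem MonModule.zero_le (a : S) : mm.le mm.zero a :=
  ⟨a, by rw [mm.add_comm, mm.add_zero]⟩

theorem MonModule.add_le_add {a b c d : S} :
    mm.le a b → mm.le c d → mm.le (mm.add a c) (mm.add b d) := by
  rintro ⟨u, rfl⟩ ⟨v, rfl⟩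
  refine ⟨mm.add u v, ?_⟩
  let _ : Std.Associative mm.add := ⟨mm.add_assoc⟩
  let _ : Std.Commutative mm.add := ⟨mm.add_comm⟩
  ac_rfl

theorem MonModule.smul_le_smul (u : M) {a b : S} :
    mm.le a b → mm.le (mm.smul u a) (mm.smul u b) := by
  rintro ⟨c, rfl⟩
  exact ⟨mm.smul u c, (mm.smul_add u a c).symm⟩

theorem MonModule.Chain.le {s : ℕ → S} (hs : mm.Chain s) {m n : ℕ} (h : m ≤ n) :
    mm.le (s m) (s n) := by
  induction h with
  | refl => exact mm.le_refl _
  | step _ ih => exact MonModule.le_trans ih (hs _)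

theorem MonModule.IsSup.unique (hord : mm.NaturallyOrdered) {s : ℕ → S} {x y : S}
    (hx : mm.IsSup s x) (hy : mm.IsSup s y) : x = y :=
  hord x y (hx.2 y hy.1) (hy.2 x hx.1)

theorem MonModule.IsSup.succ {s : ℕ → S} (hs : mm.Chain s) {x : S} (hx : mm.IsSup s x) :
    mm.IsSup (fun n => s (n + 1)) x :=
  ⟨fun n => hx.1 (n + 1), fun y hy => hx.2 y fun n => MonModule.le_trans (hs n) (hy n)⟩

theorem MonModule.isSup_const (a : S) : mm.IsSup (fun _ => a) a :=
  ⟨fun _ => mm.le_refl a, fun _ hy => hy 0⟩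

theorem OmegaContinuous.isSup_add (hcont : OmegaContinuous mm) {s t : ℕ → S} {x y : S}
    (hs : mm.Chain s) (ht : mm.Chain t) (hx : mm.IsSup s x) (hy : mm.IsSup t y) :
    mm.IsSup (fun n => mm.add (s n) (t n)) (mm.add x y) := by
  refine ⟨fun n => MonModule.add_le_add (hx.1 n) (hy.1 n), fun z hz => ?_⟩
  rw [mm.add_comm]
  refine (hcont.add_cont y s x hs hx).2 z fun n => ?_
  beta_reduce
  rw [mm.add_comm]
  exact (hcont.add_cont (s n) t y ht hy).2 z fun m =>
    MonModule.le_trans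
      (MonModule.add_le_add (hs.le (le_max_left n m)) (ht.le (le_max_right n m))) (hz _)

end Order

section Continuity

variable {M S St : Type} [Monoid M] {mm : MonModule M S}

theorem wle_antisymm (hord : mm.NaturallyOrdered) {f g : St → S} (hfg : wle mm f g)
    (hgf : wle mm g f) : f = g :=
  funext fun σ => hord _ _ (hfg σ) (hgf σ)

/-- A weighting transformer is ω-continuous if it is monotone and preserves pointwise suprema
of ω-chains. -/
structure WContinuous (mm : MonModule M S) (T : (St → S) → St → S) : Prop where
  mono : ∀ f g : St → S, wle mm f g → wle mm (T f) (T g)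
  isSup : ∀ (s : ℕ → St → S) (x : St → S), WChain mm s →
    (∀ σ, mm.IsSup (fun n => s n σ) (x σ)) → ∀ σ, mm.IsSup (fun n => T (s n) σ) (T x σ)

theorem WContinuous.comp {T U : (St → S) → St → S} (hT : WContinuous mm T)
    (hU : WContinuous mm U) : WContinuous mm (fun f => T (U f)) :=
  ⟨fun _ _ h => hT.mono _ _ (hU.mono _ _ h), fun s x hs hx =>
    hT.isSup (fun n => U (s n)) (U x) (fun n => hU.mono _ _ (hs n)) (hU.isSup s x hs hx)⟩

theorem WContinuous.add (hcont : OmegaContinuous mm) {T U : (St → S) → St → S}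
    (hT : WContinuous mm T) (hU : WContinuous mm U) :
    WContinuous mm (fun f σ => mm.add (T f σ) (U f σ)) :=
  ⟨fun _ _ h σ => MonModule.add_le_add (hT.mono _ _ h σ) (hU.mono _ _ h σ),
    fun s x hs hx σ => hcont.isSup_add (fun n => hT.mono _ _ (hs n) σ)
      (fun n => hU.mono _ _ (hs n) σ) (hT.isSup s x hs hx σ) (hU.isSup s x hs hx σ)⟩

theorem WContinuous.iv (φ : Set St) : WContinuous mm (iv mm φ) := by
  refine ⟨fun f g h σ => ?_, fun s x hs hx σ => ?_⟩
  · by_cases hσ : σ ∈ φ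
    · simpa [_root_.iv, hσ] using h σ
    · simpa [_root_.iv, hσ] using mm.le_refl mm.zero
  · by_cases hσ : σ ∈ φ
    · simpa [_root_.iv, hσ] using hx σ
    · simpa [_root_.iv, hσ] using MonModule.isSup_const mm.zero

theorem OmegaContinuous.wsup_exists (hcont : OmegaContinuous mm) {s : ℕ → St → S}
    (hs : WChain mm s) : ∃ x : St → S, ∀ σ, mm.IsSup (fun n => s n σ) (x σ) :=
  Classical.skolem.1 fun σ => hcont.sup_exists _ fun n => hs n σ

/-- Kleene's fixed point theorem: an ω-continuous transformer has a fixed point below all of its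
prefixed points. -/
theorem WContinuous.exists_least_fixed (hord : mm.NaturallyOrdered) (hcont : OmegaContinuous mm)
    {T : (St → S) → St → S} (hT : WContinuous mm T) :
    ∃ x, T x = x ∧ ∀ y, wle mm (T y) y → wle mm x y := by
  let s : ℕ → St → S := fun n => T^[n] fun _ => mm.zero
  have hsucc : ∀ n, s (n + 1) = T (s n) := fun n => Function.iterate_succ_apply' T n _
  have hs : WChain mm s := by
    intro n
    induction n with
    | zero => exact fun σ => MonModule.zero_le _
    | succ n ih =>
      rw [hsucc, hsucc (n + 1)]
      exact hT.mono _ _ ih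
  obtain ⟨x, hx⟩ := hcont.wsup_exists hs
  refine ⟨x, funext fun σ => ?_, fun y hy σ => (hx σ).2 _ fun n => ?_⟩
  · have h := hT.isSup s x hs hx σ
    simp only [← hsucc] at h
    exact h.unique hord ((hx σ).succ fun n => hs n σ)
  · have key : wle mm (s n) y := by
      induction n with
      | zero => exact fun σ => MonModule.zero_le _
      | succ n ih =>
        rw [hsucc]
        exact fun σ => MonModule.le_trans (hT.mono _ _ ih σ) (hy σ)
    exact key σ

theorem WContinuous.wlfp_spec (hord : mm.NaturallyOrdered) (hcont : OmegaContinuous mm)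
    {T : (St → S) → St → S} (hT : WContinuous mm T) :
    T (wlfp mm T) = wlfp mm T ∧ ∀ y, wle mm (T y) y → wle mm (wlfp mm T) y := by
  obtain ⟨x, hx, hle⟩ := hT.exists_least_fixed hord hcont
  have hex : ∃ x : St → S, T x = x ∧ ∀ y : St → S, T y = y → wle mm x y :=
    ⟨x, hx, fun y hy => hle y fun σ => MonModule.le_of_eq (congrFun hy σ)⟩
  have hw : wlfp mm T = hex.choose := dif_pos hex
  have hspec := hex.choose_spec
  rw [← hw] at hspec
  exact ⟨hspec.1, fun y hy σ => MonModule.le_trans (hspec.2 x hx σ) (hle y hy σ)⟩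

/-- The least fixed point of `X ↦ B f ⊕ H X` depends ω-continuously on `f`. -/
theorem WContinuous.wlfp_add (hord : mm.NaturallyOrdered) (hcont : OmegaContinuous mm)
    {B H : (St → S) → St → S} (hB : WContinuous mm B) (hH : WContinuous mm H) :
    WContinuous mm (fun f => wlfp mm fun X σ => mm.add (B f σ) (H X σ)) := by
  have hconst : ∀ f, WContinuous mm (fun _ : St → S => B f) := fun f =>
    ⟨fun _ _ _ σ => mm.le_refl _, fun _ _ _ _ σ => MonModule.isSup_const _⟩
  have hspec := fun f => ((hconst f).add hcont hH).wlfp_spec hord hcont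
  set L : (St → S) → St → S := fun f => wlfp mm fun X σ => mm.add (B f σ) (H X σ)
  have hmono : ∀ f g, wle mm f g → wle mm (L f) (L g) := fun f g h =>
    (hspec f).2 _ fun σ => MonModule.le_trans
      (MonModule.add_le_add (hB.mono _ _ h σ) (mm.le_refl _))
      (MonModule.le_of_eq (congrFun (hspec g).1 σ))
  refine ⟨hmono, fun s x hs hx => ?_⟩
  have hchain : WChain mm (fun n => L (s n)) := fun n => hmono _ _ (hs n)
  obtain ⟨y, hy⟩ := hcont.wsup_exists hchain
  have hfix : ∀ σ, mm.add (B x σ) (H y σ) = y σ := fun σ => by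
    have h := hcont.isSup_add (fun n => hB.mono _ _ (hs n) σ)
      (fun n => hH.mono _ _ (hchain n) σ) (hB.isSup s x hs hx σ) (hH.isSup _ y hchain hy σ)
    have heq : ∀ n, mm.add (B (s n) σ) (H (L (s n)) σ) = L (s n) σ :=
      fun n => congrFun (hspec (s n)).1 σ
    simp only [heq] at h
    exact h.unique hord (hy σ)
  have hle : wle mm (L x) y := (hspec x).2 y fun σ => MonModule.le_of_eq (hfix σ)
  have hge : wle mm y (L x) := fun σ =>
    (hy σ).2 _ fun n => hmono _ _ (fun τ => (hx τ).1 n) σ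
  rw [wle_antisymm hord hle hge]
  exact hy

theorem wp_continuous (hord : mm.NaturallyOrdered) (hcont : OmegaContinuous mm)
    (C : WGCL M St) : WContinuous mm (wp mm C) := by
  induction C with
  | assign g => exact ⟨fun _ _ h σ => h (g σ), fun _ _ _ hx σ => hx (g σ)⟩
  | seq C₁ C₂ ih₁ ih₂ => exact ih₁.comp ih₂
  | ite φ C₁ C₂ ih₁ ih₂ =>
    exact ((WContinuous.iv φ).comp ih₁).add hcont ((WContinuous.iv φᶜ).comp ih₂)
  | branch C₁ C₂ ih₁ ih₂ => exact ih₁.add hcont ih₂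
  | weight a =>
    exact ⟨fun _ _ h σ => MonModule.smul_le_smul a (h σ),
      fun _ _ hs hx σ => hcont.smul_cont a _ _ (fun n => hs n σ) (hx σ)⟩
  | wloop φ C ih =>
    exact (WContinuous.iv φᶜ).wlfp_add hord hcont ((WContinuous.iv φ).comp ih)

end Continuity

/-- **Monotonicity of wp**: for a naturally ordered ω-continuous `M`-module `S`, the
transformer `wp[C]` is monotone w.r.t. the pointwise natural order on weightings. -/
theorem wp_monotone (M S St : Type) [Monoid M] [Countable St] (mm : MonModule M S)
    (hord : mm.NaturallyOrdered) (hcont : OmegaContinuous mm) :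
    ∀ (C : WGCL M St) (f g : St → S), wle mm f g → wle mm (wp mm C f) (wp mm C g) := by
  exact fun C => (wp_continuous hord hcont C).mono
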